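/- Assume that for every x ∈ ℂ^{n+1} with g₁(x) = … = g_k(x) = 0 and F(x) ≠ 0 the matrix J_g(x) has rank c. Then for every η ∈ ℂ^{n+1} and every x ∈ ℂ^{n+1} with g₁(x) = … = g_k(x) = 0 and F(x) ≠ 0, the following are equivalent: (a) every minor of size c+1 of A(x,η) vanishes; (b) η·x = d and every minor of size c+2 of B(x,η) vanishes. In particular, the projectivization map x ↦ [x] is a bijection from the set of critical points of the log likelihood ℓ_{F,η} on the punctured cone {g₁ = … = g_k = 0, F ≠ 0} onto the set of critical points of log f_{F,η} on X ∖ D_{F,η}, described in the affine chart η·x = d by condition (b). -/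

import Mathlib

open MvPolynomial

/-- Gradient of a multivariate polynomial at a point. -/
noncomputable def grad {n : ℕ} (P : MvPolynomial (Fin (n+1)) ℂ) (x : Fin (n+1) → ℂ) :
    Fin (n+1) → ℂ := fun j => eval x (pderiv j P)

/-- The k×(n+1) Jacobian matrix of g₁,…,g_k at x. -/
noncomputable def Jmat {n k : ℕ} (g : Fin k → MvPolynomial (Fin (n+1)) ℂ)
    (x : Fin (n+1) → ℂ) : Matrix (Fin k) (Fin (n+1)) ℂ :=
  Matrix.of fun i j => grad (g i) x j

/-- The (k+1)×(n+1) matrix A(x,η) with first row (1/F(x))∇F(x) − η and remaining rows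
the rows of the Jacobian of g₁,…,g_k. -/
noncomputable def Amat {n k : ℕ} (F : MvPolynomial (Fin (n+1)) ℂ)
    (g : Fin k → MvPolynomial (Fin (n+1)) ℂ) (x η : Fin (n+1) → ℂ) :
    Matrix (Fin (k+1)) (Fin (n+1)) ℂ :=
  Matrix.of (Fin.cons (fun j => (eval x F)⁻¹ * grad F x j - η j) (fun i => grad (g i) x))

/-- The (k+2)×(n+1) matrix B(x,η) with rows (1/F(x))∇F(x), η, and the rows of the Jacobian
of g₁,…,g_k. -/
noncomputable def Bmat {n k : ℕ} (F : MvPolynomial (Fin (n+1)) ℂ)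
    (g : Fin k → MvPolynomial (Fin (n+1)) ℂ) (x η : Fin (n+1) → ℂ) :
    Matrix (Fin (k+2)) (Fin (n+1)) ℂ :=
  Matrix.of (Fin.cons (fun j => (eval x F)⁻¹ * grad F x j) (Fin.cons η (fun i => grad (g i) x)))

/-- All minors of size r of M vanish. -/
def minorsVanish {m N : ℕ} (r : ℕ) (M : Matrix (Fin m) (Fin N) ℂ) : Prop :=
  ∀ (f : Fin r → Fin m) (s : Fin r → Fin N),
    Function.Injective f → Function.Injective s → (M.submatrix f s).det = 0

open Module Submodule

/-- A matrix of rank at least `r` has `r` linearly independent rows. -/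
lemma Matrix.exists_linearIndependent_rows {K m n : Type*} [Field K] [Finite m] [Fintype n]
    (M : Matrix m n K) {r : ℕ} (h : r ≤ M.rank) :
    ∃ f : Fin r → m, Function.Injective f ∧ LinearIndependent K fun i => M.row (f i) := by
  obtain ⟨κ, a, ha, hspan, hli⟩ := exists_linearIndependent' K M.row
  have : Finite κ := Finite.of_injective a ha
  have : Fintype κ := Fintype.ofFinite κ
  have hcard : M.rank = Fintype.card κ := by
    rw [M.rank_eq_finrank_span_row, ← hspan, finrank_span_eq_card hli]
  let e : Fin r ↪ κ := (Fin.castLEEmb (h.trans_eq hcard)).trans (Fintype.equivFin κ).symm.toEmbedding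
  exact ⟨a ∘ e, ha.comp e.injective, hli.comp e e.injective⟩

/-- The minors of size `r` of a matrix all vanish if and only if its rank is less than `r`. -/
lemma minorsVanish_iff_rank_lt {m N r : ℕ} (M : Matrix (Fin m) (Fin N) ℂ) :
    minorsVanish r M ↔ M.rank < r := by
  constructor
  · intro h
    by_contra! hr
    obtain ⟨f, hf, hfli⟩ := M.exists_linearIndependent_rows hr
    have hrank : r ≤ ((M.submatrix f id).transpose).rank := by
      rw [Matrix.rank_transpose, LinearIndependent.rank_matrix (M := M.submatrix f id) hfli,
        Fintype.card_fin]
    obtain ⟨s, hs, hsli⟩ := Matrix.exists_linearIndependent_rows _ hrank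
    have hunit : IsUnit (M.submatrix f s).transpose :=
      Matrix.linearIndependent_rows_iff_isUnit.1 hsli
    rw [Matrix.isUnit_iff_isUnit_det, Matrix.det_transpose] at hunit
    exact hunit.ne_zero (h f s hf hs)
  · intro h f s _ _
    by_contra hdet
    have := Matrix.rank_submatrix_le M f s
    rw [Matrix.rank_of_det_ne_zero hdet, Fintype.card_fin] at this
    omega

section Span

variable {K V : Type*} [Field K] [AddCommGroup V] [Module K V] [FiniteDimensional K V]

lemma finrank_span_insert_of_notMem {s : Set V} {v : V} (h : v ∉ span K s) :
    finrank K (span K (insert v s)) = finrank K (span K s) + 1 := by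
  rw [span_insert, sup_comm, finrank_sup_span_singleton h]

lemma finrank_span_insert_lt_iff {s : Set V} {v : V} :
    finrank K (span K (insert v s)) < finrank K (span K s) + 1 ↔ v ∈ span K s := by
  refine ⟨fun h => ?_, fun h => by rw [span_insert_eq_span h]; omega⟩
  by_contra hv
  rw [finrank_span_insert_of_notMem hv] at h
  exact h.false

/-- If a functional `φ` kills `s` but not `u`, then `u - v` lies in the span of `s` exactly when
`φ v = φ u` and `v` does not enlarge the span of `u` and `s`. -/
lemma sub_mem_span_iff_of_functional {s : Set V} (φ : V →ₗ[K] K) {u : V} (v : V)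
    (hs : ∀ w ∈ s, φ w = 0) (hu : φ u ≠ 0) :
    u - v ∈ span K s ↔
      φ v = φ u ∧ finrank K (span K (insert u (insert v s))) < finrank K (span K s) + 2 := by
  have hspan : span K s ≤ LinearMap.ker φ := span_le.2 hs
  have hus : u ∉ span K s := fun h => hu (hspan h)
  rw [Set.insert_comm, ← add_assoc (finrank K (span K s)) 1 1,
    ← finrank_span_insert_of_notMem hus, finrank_span_insert_lt_iff, mem_span_insert]
  constructor
  · intro h
    have := LinearMap.mem_ker.1 (hspan h)
    rw [map_sub, sub_eq_zero] at this
    exact ⟨this.symm, 1, v - u, by simpa using neg_mem h, by simp⟩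
  · rintro ⟨hv, a, z, hz, rfl⟩
    have hz0 : φ z = 0 := hspan hz
    have ha : a = 1 := by simpa [hz0, hu] using hv
    simpa [ha] using hz

end Span

/-- Euler's identity for the gradient of a homogeneous polynomial. -/
lemma sum_grad_mul {n d : ℕ} {P : MvPolynomial (Fin (n+1)) ℂ} (hP : P.IsHomogeneous d)
    (x : Fin (n+1) → ℂ) : ∑ j, grad P x j * x j = d * eval x P := by
  simpa [grad, mul_comm] using congrArg (eval x) hP.sum_X_mul_pderiv

/-- Pointwise, x is a critical point of ℓ_{F,η} on the punctured cone (all (c+1)-minors of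
A(x,η) vanish) iff η·x = d and x is a critical point of log f_{F,η} in the affine chart
η·x = d (all (c+2)-minors of B(x,η) vanish). -/
theorem stmt7 {n k c d : ℕ} (hc : c ≤ min k n) (hd : 1 ≤ d)
    (g : Fin k → MvPolynomial (Fin (n+1)) ℂ) (F : MvPolynomial (Fin (n+1)) ℂ)
    (hg : ∀ i, ∃ m, (g i).IsHomogeneous m) (hF : F.IsHomogeneous d)
    (hrank : ∀ x : Fin (n+1) → ℂ, (∀ i, eval x (g i) = 0) → eval x F ≠ 0 →
      (Jmat g x).rank = c)
    (η x : Fin (n+1) → ℂ)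
    (hgx : ∀ i, eval x (g i) = 0) (hFx : eval x F ≠ 0) :
    minorsVanish (c+1) (Amat F g x η) ↔
      (∑ j, η j * x j = (d : ℂ) ∧ minorsVanish (c+2) (Bmat F g x η)) := by
  rw [minorsVanish_iff_rank_lt, minorsVanish_iff_rank_lt, Matrix.rank_eq_finrank_span_row,
    Matrix.rank_eq_finrank_span_row]
  have hJ : finrank ℂ (span ℂ (Set.range fun i => grad (g i) x)) = c := by
    rw [← hrank x hgx hFx, Matrix.rank_eq_finrank_span_row]
    rfl
  set u : Fin (n+1) → ℂ := fun j => (eval x F)⁻¹ * grad F x j with hu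
  have hA : Set.range (Amat F g x η).row =
      insert (u - η) (Set.range fun i => grad (g i) x) := Fin.range_cons _ _
  have hB : Set.range (Bmat F g x η).row =
      insert u (insert η (Set.range fun i => grad (g i) x)) :=
    (Fin.range_cons _ _).trans (congrArg _ (Fin.range_cons _ _))
  let φ : (Fin (n+1) → ℂ) →ₗ[ℂ] ℂ := Fintype.linearCombination ℂ x
  have hφ (w : Fin (n+1) → ℂ) : φ w = ∑ j, w j * x j := Fintype.linearCombination_apply ..
  have hφu : φ u = d := by
    simp_rw [hφ, hu, mul_assoc, ← Finset.mul_sum, sum_grad_mul hF]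
    field_simp
  have hφg : ∀ w ∈ Set.range fun i => grad (g i) x, φ w = 0 := by
    rintro _ ⟨i, rfl⟩
    obtain ⟨m, hm⟩ := hg i
    rw [hφ, sum_grad_mul hm, hgx, mul_zero]
  have hφu0 : φ u ≠ 0 := by
    rw [hφu]
    exact_mod_cast Nat.one_le_iff_ne_zero.1 hd
  rw [hA, hB, ← hJ, finrank_span_insert_lt_iff, sub_mem_span_iff_of_functional φ η hφg hφu0, hφu,
    hφ]
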